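/- arXiv:1508.07753 — 3 statements merged into one kernel-verified Lean document; each statement's English description precedes it below -/
import Mathlib

section
/- Let H be a group DAG on a grouping W of a finite node set N (so N is the union of the groups). Suppose that either (a) every group in W has size 1, or (b) every group in W has size at most 2 and no group of size 2 is adjacent to any other group in H. Then every distribution p on N that is groupwise faithful to H given W is faithful to some DAG on N. -/
open scoped Classical

namespace GroupBN

variable {V : Type*} {I : Type*}

/-- `u` and `v` are adjacent in the digraph with arc relation `A`. -/
def Adj (A : V → V → Prop) (u v : V) : Prop := A u v ∨ A v u

/-- `A` is the arc relation of a DAG: there are no directed cycles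
(in particular `A` is irreflexive). -/
def IsDAG (A : V → V → Prop) : Prop := ∀ v : V, ¬ Relation.TransGen A v v

/-- `u` is an ancestor of `v`: there is a nonempty directed path from `u` to `v`. -/
def Ancestor (A : V → V → Prop) (u v : V) : Prop := Relation.TransGen A u v

/-- `u` and `v` are d-connected given `Z`: there is a path (an injective sequence of
pairwise adjacent consecutive nodes) from `u` to `v` such that every head-to-head
interior node is in `Z` or has a descendant in `Z`, and no other interior node is
in `Z`. -/
def DConn (A : V → V → Prop) (Z : Set V) (u v : V) : Prop :=
  ∃ (n : ℕ) (pth : Fin (n + 2) → V),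
    Function.Injective pth ∧
    pth 0 = u ∧ pth (Fin.last (n + 1)) = v ∧
    (∀ (k : ℕ) (h : k + 1 < n + 2),
      Adj A (pth ⟨k, Nat.lt_of_succ_lt h⟩) (pth ⟨k + 1, h⟩)) ∧
    (∀ (k : ℕ) (h : k + 2 < n + 2),
      (A (pth ⟨k, by omega⟩) (pth ⟨k + 1, by omega⟩) ∧
         A (pth ⟨k + 2, h⟩) (pth ⟨k + 1, by omega⟩) →
        (pth ⟨k + 1, by omega⟩ ∈ Z ∨ ∃ d ∈ Z, Ancestor A (pth ⟨k + 1, by omega⟩) d)) ∧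
      (¬ (A (pth ⟨k, by omega⟩) (pth ⟨k + 1, by omega⟩) ∧
            A (pth ⟨k + 2, h⟩) (pth ⟨k + 1, by omega⟩)) →
        pth ⟨k + 1, by omega⟩ ∉ Z))

/-- `u` and `v` are d-separated by `Z`. -/
def DSep (A : V → V → Prop) (Z : Set V) (u v : V) : Prop := ¬ DConn A Z u v

/-- The node sets `X` and `Y` are d-separated by `Z`. -/
def DSepSet (A : V → V → Prop) (Z X Y : Set V) : Prop :=
  ∀ x ∈ X, ∀ y ∈ Y, DSep A Z x y

variable {S : V → Type*}

/-- `p` is a probability mass function on the joint state space. -/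
def IsDist [Fintype V] [DecidableEq V] [∀ v, Fintype (S v)]
    (p : (∀ v, S v) → ℝ) : Prop :=
  (∀ f, 0 ≤ p f) ∧ ∑ f, p f = 1

/-- Marginal probability, under `p`, of the event that the variables in `X` take
the values prescribed by the assignment `a`. -/
noncomputable def margin [Fintype V] [DecidableEq V] [∀ v, Fintype (S v)]
    (p : (∀ v, S v) → ℝ) (X : Set V) (a : ∀ v, S v) : ℝ :=
  ∑ f : ∀ v, S v, if ∀ v ∈ X, f v = a v then p f else 0

/-- Conditional independence `X ⊥ Y | Z` in `p`, in cross-multiplied form: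
for every assignment whose `Z`-part has positive probability,
`P(X,Y,Z) · P(Z) = P(X,Z) · P(Y,Z)`. -/
def CondIndep [Fintype V] [DecidableEq V] [∀ v, Fintype (S v)]
    (p : (∀ v, S v) → ℝ) (X Y Z : Set V) : Prop :=
  ∀ a : ∀ v, S v, 0 < margin p Z a →
    margin p (X ∪ Y ∪ Z) a * margin p Z a = margin p (X ∪ Z) a * margin p (Y ∪ Z) a

/-- `p` is faithful to the DAG `A`: conditional independence coincides with
d-separation for all pairwise disjoint `X`, `Y`, `Z` with `X`, `Y` nonempty. -/
def Faithful [Fintype V] [DecidableEq V] [∀ v, Fintype (S v)]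
    (p : (∀ v, S v) → ℝ) (A : V → V → Prop) : Prop :=
  ∀ X Y Z : Set V, X.Nonempty → Y.Nonempty →
    Disjoint X Y → Disjoint X Z → Disjoint Y Z →
    (CondIndep p X Y Z ↔ DSepSet A Z X Y)

/-- `p` is groupwise faithful to the group DAG `H` given the grouping whose groups
are the fibers of the surjection `π`. -/
def GroupwiseFaithful [Fintype V] [DecidableEq V] [∀ v, Fintype (S v)]
    (p : (∀ v, S v) → ℝ) (π : V → I) (H : I → I → Prop) : Prop :=
  ∀ i j : I, i ≠ j → ∀ T : Set I, i ∉ T → j ∉ T →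
    (CondIndep p (π ⁻¹' {i}) (π ⁻¹' {j}) (π ⁻¹' T) ↔ DSep H T i j)

/-- The variable DAG `A` is groupwise Markov equivalent to the group DAG `H`
given the grouping whose groups are the fibers of the surjection `π`. -/
def GroupwiseMarkovEquiv (A : V → V → Prop) (π : V → I) (H : I → I → Prop) : Prop :=
  ∀ i j : I, i ≠ j → ∀ T : Set I, i ∉ T → j ∉ T →
    (DSepSet A (π ⁻¹' T) (π ⁻¹' {i}) (π ⁻¹' {j}) ↔ DSep H T i j)

/-- The condition a path active given `Z` imposes on three consecutive nodes `a`, `b`, `c`. -/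
def OpenAt (A : V → V → Prop) (Z : Set V) (a b c : V) : Prop :=
  (A a b ∧ A c b → (b ∈ Z ∨ ∃ d ∈ Z, Ancestor A b d)) ∧ (¬ (A a b ∧ A c b) → b ∉ Z)

/-- `f 0, …, f n` is a path of positive length that is active given `Z`. -/
def ActivePath (A : V → V → Prop) (Z : Set V) (n : ℕ) (f : ℕ → V) : Prop :=
  0 < n ∧ (∀ i j, i ≤ n → j ≤ n → f i = f j → i = j) ∧
    (∀ k < n, Adj A (f k) (f (k + 1))) ∧
    ∀ k, k + 2 ≤ n → OpenAt A Z (f k) (f (k + 1)) (f (k + 2))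

theorem dConn_iff {A : V → V → Prop} {Z : Set V} {u v : V} :
    DConn A Z u v ↔ ∃ n f, ActivePath A Z n f ∧ f 0 = u ∧ f n = v := by
  constructor
  · rintro ⟨n, q, hinj, h0, hl, hadj, hopen⟩
    have hv : ∀ k (h : k < n + 2), q ⟨min k (n + 1), by omega⟩ = q ⟨k, h⟩ := fun k h => by
      congr 2; omega
    refine ⟨n + 1, fun k => q ⟨min k (n + 1), by omega⟩, ⟨by omega, ?_, ?_, ?_⟩, ?_, ?_⟩
    · intro i j hi hj h
      have := congrArg Fin.val (hinj h)
      simp only at this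
      omega
    · intro k hk
      simpa only [hv k (by omega), hv (k + 1) (by omega)] using hadj k (by omega)
    · intro k hk
      simp only [hv k (by omega), hv (k + 1) (by omega), hv (k + 2) (by omega)]
      exact hopen k (by omega)
    · simpa using h0
    · rw [← hl]
      exact hv (n + 1) (by omega)
  · rintro ⟨n, f, ⟨hn, hinj, hadj, hopen⟩, rfl, rfl⟩
    obtain ⟨n, rfl⟩ : ∃ m, n = m + 1 := ⟨n - 1, by omega⟩
    refine ⟨n, fun i => f i, ?_, rfl, rfl, fun k h => hadj k (by omega),
      fun k h => hopen k (by omega)⟩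
    intro i j h
    exact Fin.ext (hinj i j (by omega) (by omega) h)

theorem OpenAt.symm {A : V → V → Prop} {Z : Set V} {a b c : V} (h : OpenAt A Z a b c) :
    OpenAt A Z c b a := by
  unfold OpenAt at *
  tauto

theorem DConn.symm {A : V → V → Prop} {Z : Set V} {u v : V} (h : DConn A Z u v) :
    DConn A Z v u := by
  obtain ⟨n, f, ⟨hn, hinj, hadj, hopen⟩, rfl, rfl⟩ := dConn_iff.1 h
  refine dConn_iff.2 ⟨n, fun k => f (n - k), ⟨hn, ?_, ?_, ?_⟩, by simp, by simp⟩
  · intro i j hi hj h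
    have := hinj _ _ (by omega) (by omega) h
    omega
  · intro k hk
    have := hadj (n - (k + 1)) (by omega)
    rw [show n - (k + 1) + 1 = n - k by omega] at this
    exact this.symm
  · intro k hk
    have := (hopen (n - (k + 2)) (by omega)).symm
    rwa [show n - (k + 2) + 1 = n - (k + 1) by omega,
      show n - (k + 2) + 2 = n - k by omega] at this

theorem DSep.symm {A : V → V → Prop} {Z : Set V} {u v : V} (h : DSep A Z u v) :
    DSep A Z v u :=
  fun h' => h h'.symm

theorem exists_directed_seq {A : V → V → Prop} {c w : V} (h : Relation.ReflTransGen A c w) :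
    ∃ m, ∃ d : ℕ → V, d 0 = c ∧ d m = w ∧ ∀ k < m, A (d k) (d (k + 1)) := by
  induction h using Relation.ReflTransGen.head_induction_on with
  | refl => exact ⟨0, fun _ => w, rfl, rfl, by simp⟩
  | @head a b hab _ ih =>
    obtain ⟨m, d, h0, hm, hd⟩ := ih
    refine ⟨m + 1, fun k => if k = 0 then a else d (k - 1), by simp, by simp [hm], ?_⟩
    rintro (_ | k) hk
    · simpa [h0] using hab
    · simpa using hd k (by omega)

theorem transGen_of_directed_seq {A : V → V → Prop} {m : ℕ} {d : ℕ → V}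
    (hd : ∀ k < m, A (d k) (d (k + 1))) (i j : ℕ) (hij : i < j) (hj : j ≤ m) :
    Relation.TransGen A (d i) (d j) := by
  induction j, hij using Nat.le_induction with
  | base => exact .single (hd i (by omega))
  | succ j hij ih => exact (ih (by omega)).tail (hd j (by omega))

/-- Follow an active path up to node `m`, then a directed path out of that node. -/
theorem dConn_of_prefix_directed {A : V → V → Prop} (hA : IsDAG A) {Z : Set V} {n m t : ℕ}
    {f d : ℕ → V} (hinj : ∀ i j, i ≤ n → j ≤ n → f i = f j → i = j)
    (hadj : ∀ k < n, Adj A (f k) (f (k + 1)))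
    (hopen : ∀ k, k + 2 ≤ t → OpenAt A Z (f k) (f (k + 1)) (f (k + 2)))
    (htn : t ≤ n) (hd : ∀ k < m, A (d k) (d (k + 1))) (hZ : ∀ k < m, d k ∉ Z)
    (hft : f t = d 0) (hdisj : ∀ i < t, ∀ j ≤ m, f i ≠ d j) (hpos : 0 < t + m) :
    DConn A Z (f 0) (d m) := by
  have hasymm : ∀ a b, A a b → ¬ A b a := fun a b h h' => hA a (.tail (.single h) h')
  have hdinj : ∀ i j, i ≤ m → j ≤ m → d i = d j → i = j := by
    intro i j hi hj h
    rcases lt_trichotomy i j with hij | hij | hij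
    · exact absurd (h ▸ transGen_of_directed_seq hd i j hij hj) (hA _)
    · exact hij
    · exact absurd (h ▸ transGen_of_directed_seq hd j i hij hi) (hA _)
  have hg1 : ∀ k, k ≤ t → (if k ≤ t then f k else d (k - t)) = f k := fun k hk => if_pos hk
  have hg2 : ∀ k, t ≤ k → (if k ≤ t then f k else d (k - t)) = d (k - t) := by
    intro k hk
    split_ifs with h
    · obtain rfl : k = t := le_antisymm h hk
      simpa using hft
    · rfl
  refine dConn_iff.2 ⟨t + m, fun k => if k ≤ t then f k else d (k - t), ⟨hpos, ?_, ?_, ?_⟩,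
    by simp, (hg2 (t + m) (by omega)).trans (by simp)⟩
  · intro i j hi hj h
    simp only at h
    rcases lt_or_ge i t with hi' | hi' <;> rcases lt_or_ge j t with hj' | hj'
    · rw [hg1 _ hi'.le, hg1 _ hj'.le] at h
      exact hinj _ _ (by omega) (by omega) h
    · rw [hg1 _ hi'.le, hg2 _ hj'] at h
      exact absurd h (hdisj _ hi' _ (by omega))
    · rw [hg2 _ hi', hg1 _ hj'.le] at h
      exact absurd h.symm (hdisj _ hj' _ (by omega))
    · rw [hg2 _ hi', hg2 _ hj'] at h
      have := hdinj _ _ (by omega) (by omega) h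
      omega
  · intro k hk
    simp only
    rcases lt_or_ge k t with hk' | hk'
    · rw [hg1 _ hk'.le, hg1 _ hk']
      exact hadj k (by omega)
    · rw [hg2 _ hk', hg2 _ (by omega), show k + 1 - t = k - t + 1 by omega]
      exact Or.inl (hd _ (by omega))
  · intro k hk
    simp only
    rcases le_or_gt (k + 2) t with hk' | hk'
    · rw [hg1 _ (by omega), hg1 _ (by omega), hg1 _ hk']
      exact hopen k hk'
    · rw [hg2 (k + 1) (by omega), hg2 (k + 2) (by omega),
        show k + 2 - t = k + 1 - t + 1 by omega]
      have h1 := hd (k + 1 - t) (by omega)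
      exact ⟨fun h => absurd h.2 (hasymm _ _ h1), fun _ => hZ _ (by omega)⟩

/-- Conditioning on one more node `w` only opens connections that pass through `w`. -/
theorem dConn_of_dConn_insert {A : V → V → Prop} (hA : IsDAG A) {Z : Set V} {x y w : V}
    (hxw : x ≠ w) (h : DConn A (insert w Z) x y) : DConn A Z x y ∨ DConn A Z x w := by
  obtain ⟨n, f, ⟨hn, hinj, hadj, hopen⟩, rfl, rfl⟩ := dConn_iff.1 h
  by_cases hall : ∀ k, k + 2 ≤ n → OpenAt A Z (f k) (f (k + 1)) (f (k + 2))
  · exact Or.inl (dConn_iff.2 ⟨n, f, ⟨hn, hinj, hadj, hall⟩, rfl, rfl⟩)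
  right
  push Not at hall
  obtain ⟨hk, hbad⟩ := Nat.find_spec hall
  have hmin : ∀ j, j < Nat.find hall → OpenAt A Z (f j) (f (j + 1)) (f (j + 2)) := by
    intro j hj
    have := Nat.find_min hall hj
    by_contra hc
    exact this ⟨by omega, hc⟩
  generalize Nat.find hall = k at hk hbad hmin
  have hk_open := hopen k hk
  have hcZ : f (k + 1) ∉ Z ∧ ¬ ∃ d ∈ Z, Ancestor A (f (k + 1)) d := by
    by_contra hc
    refine hbad ⟨fun _ => by tauto, fun hnc hz => hk_open.2 hnc (Set.mem_insert_of_mem _ hz)⟩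
  have hcw : Relation.ReflTransGen A (f (k + 1)) w := by
    have hcol : A (f k) (f (k + 1)) ∧ A (f (k + 2)) (f (k + 1)) := by
      by_contra hnc
      exact hbad ⟨fun h => absurd h hnc, fun _ => hcZ.1⟩
    rcases hk_open.1 hcol with h | ⟨d, hd, hda⟩
    · rcases h with h | h
      · rw [h]
      · exact absurd h hcZ.1
    · rcases hd with rfl | hd
      · exact hda.to_reflTransGen
      · exact absurd ⟨d, hd, hda⟩ hcZ.2
  obtain ⟨m, d, hd0, hdm, hd⟩ := exists_directed_seq hcw
  have hdZ : ∀ j ≤ m, d j ∉ Z := by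
    intro j hj hz
    rcases Nat.eq_zero_or_pos j with rfl | hj0
    · exact hcZ.1 (hd0 ▸ hz)
    · exact hcZ.2 ⟨d j, hz, hd0 ▸ transGen_of_directed_seq hd 0 j hj0 hj⟩
  have hmeet : ∃ t, ∃ s ≤ m, f t = d s := ⟨k + 1, 0, by omega, hd0.symm⟩
  have ht : Nat.find hmeet ≤ k + 1 := Nat.find_min' hmeet ⟨0, by omega, hd0.symm⟩
  obtain ⟨s, hs, hts⟩ := Nat.find_spec hmeet
  have hdisj : ∀ i < Nat.find hmeet, ∀ j ≤ m, f i ≠ d j :=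
    fun i hi j hj h => Nat.find_min hmeet hi ⟨j, hj, h⟩
  generalize Nat.find hmeet = t at ht hts hdisj
  have := dConn_of_prefix_directed (Z := Z) (m := m - s) (t := t) (d := fun j => d (s + j))
    hA hinj hadj (fun j hj => hmin j (by omega)) (by omega) (fun j hj => hd _ (by omega))
    (fun j hj => hdZ _ (by omega)) hts (fun i hi j hj => hdisj i hi _ (by omega)) (by
      by_contra h0
      obtain ⟨rfl, rfl⟩ : t = 0 ∧ s = m := by omega
      exact hxw (hts.trans hdm))
  rwa [show s + (m - s) = m by omega, hdm] at this

theorem DSep.insert {A : V → V → Prop} (hA : IsDAG A) {Z : Set V} {x y w : V}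
    (hxw : x ≠ w) (hxy : DSep A Z x y) (hw : DSep A Z x w) : DSep A (insert w Z) x y :=
  fun h => (dConn_of_dConn_insert hA hxw h).elim hxy hw

/-- A map that embeds a union `P` of connected components transports active paths in `P`. -/
theorem DConn.map {V' : Type*} {A : V → V → Prop} {A' : V' → V' → Prop} {Z : Set V}
    {Z' : Set V'} {g : V → V'} {P : V → Prop} (hP : ∀ a b, Adj A a b → P a → P b)
    (hinj : ∀ a b, P a → P b → g a = g b → a = b)
    (hA : ∀ a b, P a → P b → (A a b ↔ A' (g a) (g b)))
    (hZ : ∀ a, P a → (a ∈ Z ↔ g a ∈ Z')) {u v : V} (hu : P u) (h : DConn A Z u v) :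
    DConn A' Z' (g u) (g v) := by
  obtain ⟨n, f, ⟨hn, hfinj, hadj, hopen⟩, rfl, rfl⟩ := dConn_iff.1 h
  have hPf : ∀ k ≤ n, P (f k) := by
    intro k
    induction k with
    | zero => exact fun _ => hu
    | succ k ih => exact fun hk => hP _ _ (hadj k (by omega)) (ih (by omega))
  have hanc : ∀ a b, Relation.TransGen A a b → P a →
      P b ∧ Relation.TransGen A' (g a) (g b) := by
    intro a b hab ha
    induction hab with
    | single h =>
      have hb := hP _ _ (Or.inl h) ha
      exact ⟨hb, .single ((hA _ _ ha hb).1 h)⟩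
    | tail _ h ih =>
      have hb := hP _ _ (Or.inl h) ih.1
      exact ⟨hb, ih.2.tail ((hA _ _ ih.1 hb).1 h)⟩
  refine dConn_iff.2 ⟨n, g ∘ f, ⟨hn, ?_, ?_, ?_⟩, rfl, rfl⟩
  · intro i j hi hj h
    exact hfinj i j hi hj (hinj _ _ (hPf i hi) (hPf j hj) h)
  · intro k hk
    exact (hadj k hk).imp (hA _ _ (hPf k hk.le) (hPf (k + 1) hk)).1
      (hA _ _ (hPf (k + 1) hk) (hPf k hk.le)).1
  · intro k hk
    have h0 := hPf k (by omega)
    have h1 := hPf (k + 1) (by omega)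
    have h2 := hPf (k + 2) (by omega)
    obtain ⟨hc, hnc⟩ := hopen k hk
    unfold OpenAt
    simp only [Function.comp_apply]
    rw [← hA _ _ h0 h1, ← hA _ _ h2 h1, ← hZ _ h1]
    refine ⟨fun h => (hc h).imp_right ?_, hnc⟩
    rintro ⟨d, hd, hda⟩
    obtain ⟨hPd, hda'⟩ := hanc _ _ hda h1
    exact ⟨g d, (hZ _ hPd).1 hd, hda'⟩

/-- A connected node is adjacent to some node, reached without returning to the start. -/
theorem DConn.exists_adj {A : V → V → Prop} {Z : Set V} {u v : V} (h : DConn A Z u v) :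
    ∃ w, w ≠ u ∧ Adj A u w := by
  obtain ⟨n, f, ⟨hn, hinj, hadj, -⟩, rfl, rfl⟩ := dConn_iff.1 h
  refine ⟨f 1, fun h1 => ?_, hadj 0 hn⟩
  exact absurd (hinj 1 0 hn (by omega) h1) (by omega)

theorem dConn_of_adj {A : V → V → Prop} {Z : Set V} {u v : V} (huv : u ≠ v) (h : Adj A u v) :
    DConn A Z u v := by
  refine dConn_iff.2 ⟨1, fun k => if k = 0 then u else v, ⟨by omega, ?_, ?_, by omega⟩,
    by simp, by simp⟩
  · intro i j hi hj h
    simp only at h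
    split_ifs at h <;> first | omega | exact absurd h huv | exact absurd h.symm huv
  · intro k hk
    obtain rfl : k = 0 := by omega
    simpa using h

/-- Connected nodes lie in the same union of connected components. -/
theorem DConn.of_closed {A : V → V → Prop} {Z : Set V} {P : V → Prop}
    (hP : ∀ a b, Adj A a b → P a → P b) {u v : V} (hu : P u) (h : DConn A Z u v) : P v := by
  obtain ⟨n, f, ⟨hn, hfinj, hadj, hopen⟩, rfl, rfl⟩ := dConn_iff.1 h
  have hPf : ∀ k ≤ n, P (f k) := by
    intro k
    induction k with
    | zero => exact fun _ => hu
    | succ k ih => exact fun hk => hP _ _ (hadj k (by omega)) (ih (by omega))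
  exact hPf n le_rfl

section Probability

variable [Fintype V] [DecidableEq V] [∀ v, Fintype (S v)] {p : (∀ v, S v) → ℝ}

theorem margin_nonneg (hp : IsDist p) (X : Set V) (a : ∀ v, S v) : 0 ≤ margin p X a :=
  Finset.sum_nonneg fun f _ => by split_ifs <;> simp [hp.1 f]

theorem margin_anti (hp : IsDist p) {X Y : Set V} (h : X ⊆ Y) (a : ∀ v, S v) :
    margin p Y a ≤ margin p X a :=
  Finset.sum_le_sum fun f _ => by
    have := hp.1 f
    split_ifs with h1 h2
    · rfl
    · exact absurd (fun v hv => h1 v (h hv)) h2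
    · exact this
    · rfl

theorem margin_congr {X : Set V} {a b : ∀ v, S v} (h : ∀ v ∈ X, a v = b v) :
    margin p X a = margin p X b :=
  Finset.sum_congr rfl fun f _ => by
    have : (∀ v ∈ X, f v = a v) ↔ ∀ v ∈ X, f v = b v :=
      forall₂_congr fun v hv => by rw [h v hv]
    simp only [this]

theorem margin_update {X : Set V} {w : V} (hw : w ∉ X) (a : ∀ v, S v) (s : S w) :
    margin p X (Function.update a w s) = margin p X a :=
  margin_congr fun _ hv => Function.update_of_ne (ne_of_mem_of_not_mem hv hw) _ _

theorem margin_eq_sum_insert {X : Set V} {w : V} (hw : w ∉ X) (a : ∀ v, S v) :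
    margin p X a = ∑ s : S w, margin p (insert w X) (Function.update a w s) := by
  unfold margin
  rw [Finset.sum_comm]
  refine Finset.sum_congr rfl fun f _ => ?_
  have key : ∀ s : S w, (∀ v ∈ insert w X, f v = Function.update a w s v) ↔
      f w = s ∧ ∀ v ∈ X, f v = a v := by
    intro s
    rw [Set.forall_mem_insert, Function.update_self]
    refine and_congr_right fun _ => forall₂_congr fun v hv => ?_
    rw [Function.update_of_ne (ne_of_mem_of_not_mem hv hw)]
  simp only [key, ite_and]
  rw [Finset.sum_ite_eq Finset.univ (f w)]
  simp

theorem CondIndep.symm {X Y Z : Set V} (h : CondIndep p X Y Z) : CondIndep p Y X Z := by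
  intro a ha
  rw [Set.union_comm Y X, h a ha, mul_comm]

theorem condIndep_empty_right (X Z : Set V) : CondIndep p X ∅ Z := by
  intro a _
  simp

theorem CondIndep.of_insert {X Y Z : Set V} {w : V} (hX : w ∉ X) (hY : w ∉ Y) (hZ : w ∉ Z)
    (h : CondIndep p X (insert w Y) Z) : CondIndep p X Y Z := by
  intro a ha
  rw [margin_eq_sum_insert (X := X ∪ Y ∪ Z) (w := w) (by simp [hX, hY, hZ]) a,
    margin_eq_sum_insert (X := Y ∪ Z) (w := w) (by simp [hY, hZ]) a,
    Finset.sum_mul, Finset.mul_sum]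
  refine Finset.sum_congr rfl fun s _ => ?_
  have := h (Function.update a w s) (by rwa [margin_update hZ])
  rwa [margin_update hZ, margin_update (X := X ∪ Z) (by simp [hX, hZ]), Set.union_insert,
    Set.insert_union, Set.insert_union] at this

theorem CondIndep.mono_right {X Y Y' Z : Set V} (hXY : Disjoint X Y) (hYZ : Disjoint Y Z)
    (hsub : Y' ⊆ Y) (h : CondIndep p X Y Z) : CondIndep p X Y' Z := by
  suffices H : ∀ W : Set V, Disjoint W Y' → W ∪ Y' ⊆ Y → CondIndep p X (W ∪ Y') Z →
      CondIndep p X Y' Z by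
    refine H (Y \ Y') Set.disjoint_sdiff_left ?_ ?_ <;> rw [Set.sdiff_union_of_subset hsub]
    exact h
  intro W
  induction W, W.toFinite using Set.Finite.induction_on with
  | empty => intro _ _ h; simpa using h
  | @insert w W hw _ ih =>
    intro hd hs h
    rw [Set.disjoint_insert_left] at hd
    rw [Set.insert_union] at hs h
    have hwY := hs (Set.mem_insert _ _)
    exact ih hd.2 ((Set.subset_insert _ _).trans hs) (h.of_insert
      (Set.disjoint_right.1 hXY hwY) (by simp [hw, hd.1]) (Set.disjoint_left.1 hYZ hwY))

theorem CondIndep.mono {X X' Y Y' Z : Set V} (hXY : Disjoint X Y) (hXZ : Disjoint X Z)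
    (hYZ : Disjoint Y Z) (hX : X' ⊆ X) (hY : Y' ⊆ Y) (h : CondIndep p X Y Z) :
    CondIndep p X' Y' Z :=
  ((h.mono_right hXY hYZ hY).symm.mono_right (hXY.mono_right hY).symm hXZ hX).symm

theorem CondIndep.weak_union (hp : IsDist p) {X Y W Z : Set V} (hXY : Disjoint X (Y ∪ W))
    (hYZ : Disjoint (Y ∪ W) Z) (h : CondIndep p X (Y ∪ W) Z) : CondIndep p X Y (W ∪ Z) := by
  have h' := h.mono_right hXY hYZ Set.subset_union_right
  intro a ha
  have hZ : 0 < margin p Z a := ha.trans_le (margin_anti hp Set.subset_union_right a)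
  have e1 := h a hZ
  have e2 := h' a hZ
  simp only [← Set.union_assoc] at e1 e2 ⊢
  refine mul_right_cancel₀ hZ.ne' ?_
  linear_combination margin p (W ∪ Z) a * e1 - margin p (Y ∪ W ∪ Z) a * e2

theorem CondIndep.contraction (hp : IsDist p) {X Y W Z : Set V} (h1 : CondIndep p X W Z)
    (h2 : CondIndep p X Y (W ∪ Z)) : CondIndep p X (Y ∪ W) Z := by
  intro a hZ
  have e1 := h1 a hZ
  rcases (margin_nonneg hp (W ∪ Z) a).eq_or_lt with h0 | hpos
  · have hz : ∀ U : Set V, W ∪ Z ⊆ U → margin p U a = 0 := fun U hU =>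
      le_antisymm (h0 ▸ margin_anti hp hU a) (margin_nonneg hp U a)
    rw [hz (X ∪ (Y ∪ W) ∪ Z) (by grind), hz (Y ∪ W ∪ Z) (by grind)]
    simp
  · have e2 := h2 a hpos
    simp only [← Set.union_assoc] at e1 e2 ⊢
    refine mul_right_cancel₀ hpos.ne' ?_
    linear_combination margin p Z a * e2 + margin p (Y ∪ W ∪ Z) a * e1

/-- Variables `W` that are independent of `x` in every context do not affect statements
about `x`. -/
theorem condIndep_union_iff (hp : IsDist p) {x y : V} {W Z : Set V} (hxy : x ≠ y)
    (hxW : x ∉ W) (hyW : y ∉ W) (hxZ : x ∉ Z) (hyZ : y ∉ Z)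
    (hW : ∀ w ∈ W, ∀ Z' : Set V, x ∉ Z' → w ∉ Z' → CondIndep p {x} {w} Z') :
    CondIndep p {x} {y} (W ∪ Z) ↔ CondIndep p {x} {y} Z := by
  induction W, W.toFinite using Set.Finite.induction_on with
  | empty => simp
  | @insert w W hw _ ih =>
    simp only [Set.mem_insert_iff, not_or] at hxW hyW
    rw [← ih hxW.2 hyW.2 fun v hv => hW v (Set.mem_insert_of_mem _ hv), Set.insert_union]
    by_cases hwZ : w ∈ W ∪ Z
    · rw [Set.insert_eq_of_mem hwZ]
    have hx : x ∉ W ∪ Z := by simp [hxW.2, hxZ]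
    have hy : y ∉ W ∪ Z := by simp [hyW.2, hyZ]
    generalize W ∪ Z = U at hwZ hx hy
    have hind := hW w (Set.mem_insert _ _)
    have d1 : Disjoint ({x} : Set V) ({w} ∪ {y}) := by simp; grind
    have d2 : Disjoint ({w} ∪ {y}) U := by
      simp [hwZ, hy]
    rw [← Set.singleton_union]
    constructor
    · intro h
      have := (hind U hx hwZ).contraction hp h
      rw [Set.union_comm] at this
      exact this.mono_right d1 d2 (by simp)
    · intro h
      have := h.contraction hp (hind ({y} ∪ U) (by simp [hx, hxy]) (by simp [hwZ]; grind))
      rw [Set.union_comm] at this d1 d2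
      exact this.weak_union hp d1 d2

/-- Members of two independent blocks are independent given any further members of the blocks. -/
theorem CondIndep.singletons (hp : IsDist p) {X Y Z : Set V} {x y : V} (hXY : Disjoint X Y)
    (hx : x ∈ X) (hy : y ∈ Y) (hZ : Z ⊆ X ∪ Y)
    (h : CondIndep p X Y ∅) : CondIndep p {x} {y} Z := by
  have h1 : CondIndep p X ({y} ∪ Z ∩ Y) ∅ := h.mono_right hXY (by simp) (by grind)
  have d1 : Disjoint X ({y} ∪ Z ∩ Y) := hXY.mono_right (by grind)
  have h2 : CondIndep p X {y} (Z ∩ Y) := by simpa using h1.weak_union hp d1 (by simp)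
  have h3 : CondIndep p {y} ({x} ∪ Z ∩ X) (Z ∩ Y) :=
    h2.symm.mono_right (by grind) (by grind) (by grind)
  have h4 := h3.weak_union hp (by grind) (by grind)
  rw [← Set.inter_union_distrib_left, Set.inter_eq_left.2 hZ] at h4
  exact h4.symm

/-- Faithfulness only has to be checked on pairs of nodes. -/
theorem faithful_of_singletons (hp : IsDist p) {A : V → V → Prop} (hA : IsDAG A)
    (h : ∀ x y Z, x ≠ y → x ∉ Z → y ∉ Z → (CondIndep p {x} {y} Z ↔ DSep A Z x y)) :
    Faithful p A := by
  intro X Y Z hX hY hXY hXZ hYZ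
  clear hX hY
  constructor
  · intro hc x hx y hy
    refine (h x y Z ?_ ?_ ?_).1 (hc.mono hXY hXZ hYZ (by simpa) (by simpa))
    · exact fun e => Set.disjoint_left.1 hXY hx (e ▸ hy)
    · exact Set.disjoint_left.1 hXZ hx
    · exact Set.disjoint_left.1 hYZ hy
  have single : ∀ x, ∀ Y Z : Set V, x ∉ Y → x ∉ Z → Disjoint Y Z →
      (∀ y ∈ Y, DSep A Z x y) → CondIndep p {x} Y Z := by
    intro x Y
    induction Y, Y.toFinite using Set.Finite.induction_on with
    | empty => intro Z _ _ _ _; exact condIndep_empty_right _ _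
    | @insert w Y hw _ ih =>
      intro Z hxY hxZ hd hs
      rw [Set.disjoint_insert_left] at hd
      simp only [Set.mem_insert_iff, not_or] at hxY
      rw [Set.insert_eq, Set.union_comm]
      refine CondIndep.contraction hp ((h x w Z hxY.1 hxZ hd.1).2 (hs w (by simp))) ?_
      rw [Set.singleton_union]
      refine ih _ hxY.2 (by simp [hxY.1, hxZ]) (by simp [Set.disjoint_insert_right, hw, hd.2]) ?_
      intro y hy
      exact DSep.insert hA hxY.1 (hs y (by simp [hy])) (hs w (by simp))
  clear h
  induction X, X.toFinite using Set.Finite.induction_on generalizing Z with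
  | empty => intro _; exact (condIndep_empty_right _ _).symm
  | @insert w X hw _ ih =>
    intro hs
    rw [Set.disjoint_insert_left] at hXY hXZ
    refine CondIndep.symm ?_
    rw [Set.insert_eq, Set.union_comm]
    refine CondIndep.contraction hp
      (single w Y Z hXY.1 hXZ.1 hYZ (hs w (by simp))).symm (CondIndep.symm ?_)
    rw [Set.singleton_union]
    refine ih _ hXY.2 (by simp [Set.disjoint_insert_right, hw, hXZ.2])
      (by simp [Set.disjoint_insert_right, hXY.1, hYZ]) ?_
    intro x hx y hy
    have hyw : y ≠ w := fun e => hXY.1 (e ▸ hy)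
    exact (DSep.insert hA hyw (hs x (by simp [hx]) y hy).symm (hs w (by simp) y hy).symm).symm

end Probability

theorem eq_of_ncard_fiber_ne_two [Fintype V] {π : V → I}
    (hle : ∀ i, (π ⁻¹' {i}).ncard ≤ 2) {a b : V}
    (ha : (π ⁻¹' {π a}).ncard ≠ 2) (hab : π a = π b) : a = b := by
  have h1 : (π ⁻¹' {π a}).ncard ≤ 1 := by
    have := hle (π a)
    omega
  exact (Set.ncard_le_one (Set.toFinite _)).1 h1 a rfl b hab.symm

theorem eq_or_eq_of_ncard_fiber_le_two [Fintype V] {π : V → I}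
    (hle : ∀ i, (π ⁻¹' {i}).ncard ≤ 2) {a b c : V}
    (hab : a ≠ b) (hb : π b = π a) (hc : π c = π a) : c = a ∨ c = b := by
  have h := Set.eq_of_subset_of_ncard_le (s := {a, b}) (t := π ⁻¹' {π a})
    (by rintro z (rfl | rfl) <;> simp [hb]) (by rw [Set.ncard_pair hab]; exact hle _)
    (Set.toFinite _)
  have : c ∈ π ⁻¹' {π a} := hc
  simpa [← h] using this

/-- A group isolated in `H` is independent of all other groups jointly. -/
theorem condIndep_compl_of_isolated [Fintype V] [Finite I] [DecidableEq V]
    [∀ v, Fintype (S v)] {p : (∀ v, S v) → ℝ} (hp : IsDist p) {π : V → I}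
    {H : I → I → Prop} (hgf : GroupwiseFaithful p π H) {i : I}
    (hi : ∀ j, i ≠ j → ¬ Adj H i j) : CondIndep p (π ⁻¹' {i}) (π ⁻¹' {i}ᶜ) ∅ := by
  suffices h : ∀ J : Set I, i ∉ J → CondIndep p (π ⁻¹' {i}) (π ⁻¹' J) ∅ from h _ (by simp)
  intro J
  induction J, J.toFinite using Set.Finite.induction_on with
  | empty => exact fun _ => condIndep_empty_right _ _
  | @insert j J hj _ ih =>
    intro hiJ
    simp only [Set.mem_insert_iff, not_or] at hiJ
    rw [Set.insert_eq, Set.preimage_union]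
    refine (ih hiJ.2).contraction hp ?_
    rw [Set.union_empty]
    refine (hgf i j hiJ.1 J hiJ.2 hj).2 fun hc => ?_
    obtain ⟨w, hw, hadj⟩ := hc.exists_adj
    exact hi w hw.symm hadj

/-- Arcs between singleton groups follow `H`; two dependent members of the same group are joined
by an arc in the direction given by the enumeration `e`. -/
def refineArc [Fintype V] [DecidableEq V] [∀ v, Fintype (S v)] (p : (∀ v, S v) → ℝ)
    (π : V → I) (H : I → I → Prop) {n : ℕ} (e : V ≃ Fin n) (u v : V) : Prop :=
  H (π u) (π v) ∨ (π u = π v ∧ e u < e v ∧ ¬ CondIndep p {u} {v} ∅)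

theorem isDAG_refineArc [Fintype V] [DecidableEq V] [∀ v, Fintype (S v)]
    (p : (∀ v, S v) → ℝ) (π : V → I) {H : I → I → Prop} (hH : IsDAG H) {n : ℕ}
    (e : V ≃ Fin n) : IsDAG (refineArc p π H e) := by
  have key : ∀ a b, Relation.TransGen (refineArc p π H e) a b →
      Relation.TransGen H (π a) (π b) ∨ (π a = π b ∧ e a < e b) := by
    intro a b hab
    induction hab with
    | single h => exact h.imp .single fun h => ⟨h.1, h.2.1⟩
    | tail _ h ih =>
      rcases ih with ih | ⟨he, hlt⟩ <;> rcases h with h | h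
      · exact Or.inl (ih.tail h)
      · exact Or.inl (h.1 ▸ ih)
      · exact Or.inl (he ▸ .single h)
      · exact Or.inr ⟨he.trans h.1, hlt.trans h.2.1⟩
  intro v hv
  rcases key v v hv with h | h
  · exact hH _ h
  · exact lt_irrefl _ h.2

theorem faithful_refineArc [Fintype V] [Finite I] [DecidableEq V] [∀ v, Fintype (S v)]
    {p : (∀ v, S v) → ℝ} (hp : IsDist p) {π : V → I} (hπ : Function.Surjective π)
    {H : I → I → Prop} (hH : IsDAG H) (hle : ∀ i, (π ⁻¹' {i}).ncard ≤ 2)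
    (hiso : ∀ i j, (π ⁻¹' {i}).ncard = 2 → i ≠ j → ¬ Adj H i j)
    (hgf : GroupwiseFaithful p π H) {n : ℕ} (e : V ≃ Fin n) :
    Faithful p (refineArc p π H e) := by
  have hirr : ∀ i, ¬ H i i := fun i h => hH i (.single h)
  have hiso' : ∀ i j, (π ⁻¹' {i}).ncard = 2 → ¬ Adj H i j := by
    intro i j hi h
    by_cases hij : i = j
    · subst hij
      exact h.elim (hirr i) (hirr i)
    · exact hiso i j hi hij h
  have hadj_pair : ∀ a b, (π ⁻¹' {π a}).ncard = 2 → Adj (refineArc p π H e) a b →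
      π b = π a ∧ ¬ CondIndep p {a} {b} ∅ := by
    intro a b ha h
    rcases h with (h | h) | (h | h)
    · exact absurd (Or.inl h) (hiso' _ (π b) ha)
    · exact ⟨h.1.symm, h.2.2⟩
    · exact absurd (Or.inr h) (hiso' _ (π b) ha)
    · exact ⟨h.1, fun hc => h.2.2 hc.symm⟩
  have hcross : ∀ u w, (π ⁻¹' {π u}).ncard = 2 → π w ≠ π u → ∀ Z : Set V, u ∉ Z → w ∉ Z →
      CondIndep p {u} {w} Z := by
    intro u w hu hw Z _ _
    have hblock := condIndep_compl_of_isolated hp hgf fun j => hiso (π u) j hu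
    have hd : Disjoint (π ⁻¹' {π u}) (π ⁻¹' {π u}ᶜ) := by
      rw [Set.preimage_compl]
      exact disjoint_compl_right
    have hZ : Z ⊆ π ⁻¹' {π u} ∪ π ⁻¹' {π u}ᶜ := by
      rw [Set.preimage_compl, Set.union_compl_self]
      exact Set.subset_univ Z
    have hwc : w ∈ π ⁻¹' {π u}ᶜ := hw
    exact hblock.singletons hp hd (Set.mem_preimage.2 (Set.mem_singleton _)) hwc hZ
  have hsep : ∀ u w Z, (π ⁻¹' {π u}).ncard = 2 → π w ≠ π u →
      DSep (refineArc p π H e) Z u w := by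
    intro u w Z hu hw hc
    exact hw (hc.of_closed (P := fun a => π a = π u)
      (fun a b hab ha => ((hadj_pair a b (ha ▸ hu) hab).1).trans ha) rfl)
  refine faithful_of_singletons hp (isDAG_refineArc p π hH e) fun x y Z hxy hx hy => ?_
  by_cases hπxy : π y = π x
  · have hpx : (π ⁻¹' {π x}).ncard = 2 := by
      by_contra h
      exact hxy (eq_of_ncard_fiber_ne_two hle h hπxy.symm)
    have hfib := fun c => eq_or_eq_of_ncard_fiber_le_two (c := c) hle hxy hπxy
    have hZ := condIndep_union_iff hp hxy hx hy (Set.notMem_empty x) (Set.notMem_empty y)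
      fun w hw => hcross x w hpx fun hwx => (hfib w hwx).elim
        (fun h => hx (h ▸ hw)) (fun h => hy (h ▸ hw))
    rw [Set.union_empty] at hZ
    rw [hZ, ← not_iff_not]
    unfold DSep
    rw [not_not]
    constructor
    · intro h
      refine dConn_of_adj hxy ?_
      rcases lt_or_gt_of_ne (e.injective.ne hxy) with hlt | hlt
      · exact Or.inl (Or.inr ⟨hπxy.symm, hlt, h⟩)
      · exact Or.inr (Or.inr ⟨hπxy, hlt, fun hc => h hc.symm⟩)
    · intro h
      obtain ⟨w, hw, hadj⟩ := h.exists_adj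
      obtain ⟨hwx, hdep⟩ := hadj_pair x w hpx hadj
      rwa [(hfib w hwx).resolve_left hw] at hdep
  by_cases hpx : (π ⁻¹' {π x}).ncard = 2
  · exact iff_of_true (hcross x y hpx hπxy Z hx hy) (hsep x y Z hpx hπxy)
  by_cases hpy : (π ⁻¹' {π y}).ncard = 2
  · exact iff_of_true (hcross y x hpy (Ne.symm hπxy) Z hy hx).symm
      (hsep y x Z hpy (Ne.symm hπxy)).symm
  have hinj : ∀ a b, (π ⁻¹' {π a}).ncard ≠ 2 → π a = π b → a = b :=
    fun a b => eq_of_ncard_fiber_ne_two hle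
  set T : Set I := π '' {z ∈ Z | (π ⁻¹' {π z}).ncard ≠ 2} with hT
  have hmemT : ∀ a, (π ⁻¹' {π a}).ncard ≠ 2 → (a ∈ Z ↔ π a ∈ T) := by
    intro a ha
    constructor
    · exact fun h => ⟨a, ⟨h, ha⟩, rfl⟩
    · rintro ⟨z, ⟨hz, hpz⟩, hza⟩
      exact hinj z a hpz hza ▸ hz
  have hZ : Z = {z ∈ Z | (π ⁻¹' {π z}).ncard = 2} ∪ π ⁻¹' T := by
    ext z
    by_cases hpz : (π ⁻¹' {π z}).ncard = 2
    · simp only [Set.mem_union, Set.mem_ofPred_eq, hpz, and_true, Set.mem_preimage, hT]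
      refine ⟨Or.inl, Or.rec id ?_⟩
      rintro ⟨z', ⟨hz', hpz'⟩, hzz⟩
      exact hinj z' z hpz' hzz ▸ hz'
    · simp [hpz, hmemT z hpz]
  have hxT : π x ∉ T := fun h => hx ((hmemT x hpx).2 h)
  have hyT : π y ∉ T := fun h => hy ((hmemT y hpy).2 h)
  have hfx : π ⁻¹' {π x} = {x} := by
    ext z
    exact ⟨fun h => (hinj x z hpx (Eq.symm h)).symm, congrArg π⟩
  have hfy : π ⁻¹' {π y} = {y} := by
    ext z
    exact ⟨fun h => (hinj y z hpy (Eq.symm h)).symm, congrArg π⟩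
  have h1 : CondIndep p {x} {y} Z ↔ CondIndep p {x} {y} (π ⁻¹' T) := by
    conv_lhs => rw [hZ]
    refine condIndep_union_iff hp hxy (fun h => hx h.1) (fun h => hy h.1) hxT hyT ?_
    intro w hw Z' hxZ' hwZ'
    exact (hcross w x hw.2 (fun h => hpx (h ▸ hw.2)) Z' hwZ' hxZ').symm
  rw [h1, ← hfx, ← hfy, hgf _ _ (Ne.symm hπxy) T hxT hyT]
  have harc : ∀ a b, (π ⁻¹' {π a}).ncard ≠ 2 → (refineArc p π H e a b ↔ H (π a) (π b)) := by
    intro a b ha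
    refine ⟨fun h => h.resolve_right fun h => ?_, Or.inl⟩
    rw [hinj a b ha h.1] at h
    exact lt_irrefl _ h.2.1
  refine not_congr ⟨fun h => ?_, fun h => ?_⟩
  · have hs := Function.rightInverse_surjInv hπ
    have := h.map (A' := refineArc p π H e) (Z' := Z) (g := Function.surjInv hπ)
      (P := fun i => (π ⁻¹' {i}).ncard ≠ 2)
      (fun i j hij _ hj => hiso' j i hj hij.symm)
      (fun i j _ _ hij => hs.injective hij)
      (fun i j hi _ => by rw [harc _ _ (by rwa [hs i]), hs i, hs j])
      (fun i hi => by rw [hmemT _ (by rwa [hs i]), hs i]) hpx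
    rwa [hinj _ x (by rwa [hs]) (hs _), hinj _ y (by rwa [hs]) (hs _)] at this
  · refine h.map (P := fun a => (π ⁻¹' {π a}).ncard ≠ 2) ?_ (fun a b ha _ => hinj a b ha)
      (fun a b ha _ => harc a b ha) hmemT hpx
    intro a b hab ha hb
    exact ha ((hadj_pair b a hb hab.symm).1 ▸ hb)

/-- Theorem 1 of the paper. If every group has size 1, or every
group has size at most 2 and no group of size 2 is adjacent to any other group in
the group DAG `H`, then every distribution that is groupwise faithful to `H` given
the grouping is faithful to some DAG on the variables. -/
theorem groupwise_faithful_implies_faithful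
    {V I : Type*} [Fintype V] [Fintype I] [DecidableEq V]
    {S : V → Type*} [∀ v, Fintype (S v)]
    (hS : ∀ v : V, 2 ≤ Fintype.card (S v))
    (π : V → I) (hπ : Function.Surjective π)
    (H : I → I → Prop) (hH : IsDAG H)
    (hsize : (∀ i : I, (π ⁻¹' {i}).ncard = 1) ∨
      ((∀ i : I, (π ⁻¹' {i}).ncard ≤ 2) ∧
        ∀ i j : I, (π ⁻¹' {i}).ncard = 2 → i ≠ j → ¬ Adj H i j))
    (p : (∀ v, S v) → ℝ) (hp : IsDist p)
    (hgf : GroupwiseFaithful p π H) :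
    ∃ G : V → V → Prop, IsDAG G ∧ Faithful p G := by
  have hsize' : (∀ i : I, (π ⁻¹' {i}).ncard ≤ 2) ∧
      ∀ i j : I, (π ⁻¹' {i}).ncard = 2 → i ≠ j → ¬ Adj H i j := by
    rcases hsize with h | h
    · exact ⟨fun i => by simp [h i], fun i j hi => by simp [h i] at hi⟩
    · exact h
  exact ⟨refineArc p π H (Fintype.equivFin V), isDAG_refineArc p π hH _,
    faithful_refineArc hp hπ hH hsize'.1 hsize'.2 hgf _⟩

end GroupBN
end

section
/- Let H be a group DAG on a grouping W in which every group has size at least 2, and let W_j, W_k ∈ W be groups such that W_j is an ancestor of W_k in H. Then there exists a variable DAG G on the node set N = ∪W such that G is groupwise Markov equivalent to H given W and in G some node of W_k is an ancestor of some node of W_j (i.e., there is a directed path from W_k to W_j in G). Consequently, ancestry of W_j over W_k in the group DAG does not imply strong group causality of W_j on W_k. -/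
open scoped Classical

namespace GroupBN

variable {V : Type*} {I : Type*}

variable {S : V → Type*}

/-- A directed walk in a DAG is carried by a subrelation that is a simple directed path:
every node has at most one successor and at most one predecessor in it. -/
theorem exists_biunique_subrelation {H : I → I → Prop} (hH : IsDAG H) {j k : I}
    (hjk : Ancestor H j k) :
    ∃ P : I → I → Prop, (∀ x y, P x y → H x y) ∧ Relator.BiUnique P ∧
      Relation.TransGen P j k := by
  suffices h : ∃ P : I → I → Prop, (∀ x y, P x y → H x y) ∧ Relator.BiUnique P ∧
      Relation.TransGen P j k ∧ ∀ x y, P x y → Relation.ReflTransGen H y k by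
    obtain ⟨P, h₁, h₂, h₃, -⟩ := h
    exact ⟨P, h₁, h₂, h₃⟩
  induction hjk with
  | @single k h =>
    refine ⟨fun x y => x = j ∧ y = k, ?_, ⟨?_, ?_⟩, .single ⟨rfl, rfl⟩, ?_⟩
    · rintro x y ⟨rfl, rfl⟩
      exact h
    · rintro x y z ⟨rfl, -⟩ ⟨rfl, -⟩
      rfl
    · rintro x y z ⟨-, rfl⟩ ⟨-, rfl⟩
      rfl
    · rintro x y ⟨-, rfl⟩
      exact .refl
  | @tail l k _ h ih =>
    obtain ⟨P, hPH, ⟨hl, hr⟩, hP, hend⟩ := ih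
    have no_succ : ∀ y, ¬ P l y := fun y hy =>
      hH l (Relation.TransGen.head' (hPH _ _ hy) (hend _ _ hy))
    have no_pred : ∀ x, ¬ P x k := fun x hx =>
      hH k (Relation.TransGen.tail' (hend _ _ hx) h)
    refine ⟨fun x y => P x y ∨ (x = l ∧ y = k), ?_, ⟨?_, ?_⟩, ?_, ?_⟩
    · rintro x y (hxy | ⟨rfl, rfl⟩)
      · exact hPH _ _ hxy
      · exact h
    · rintro x y z (h₁ | ⟨rfl, rfl⟩) (h₂ | ⟨rfl, h₃⟩)
      · exact hl h₁ h₂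
      · exact absurd (h₃ ▸ h₁) (no_pred _)
      · exact absurd h₂ (no_pred _)
      · rfl
    · rintro x y z (h₁ | ⟨rfl, rfl⟩) (h₂ | ⟨h₃, rfl⟩)
      · exact hr h₁ h₂
      · exact absurd (h₃ ▸ h₁) (no_succ _)
      · exact absurd h₂ (no_succ _)
      · rfl
    · exact (Relation.TransGen.mono (fun _ _ => Or.inl) _ _ hP).tail (Or.inr ⟨rfl, rfl⟩)
    · rintro x y (hxy | ⟨rfl, rfl⟩)
      · exact (hend _ _ hxy).tail h
      · exact .refl

/-- The digraph on `V` consisting of a copy of `H` on the range of the section `a` of `π`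
and a copy of the reverse of `P` on the range of the section `b` of `π`. -/
def TwoLayer (π : V → I) (a b : I → V) (H P : I → I → Prop) (u v : V) : Prop :=
  (a (π u) = u ∧ a (π v) = v ∧ H (π u) (π v)) ∨
    (b (π u) = u ∧ b (π v) = v ∧ P (π v) (π u))

section TwoLayer

variable {π : V → I} {a b : I → V} {H P : I → I → Prop}

theorem transGen_twoLayer (hab : ∀ i i', a i ≠ b i') (hPH : ∀ x y, P x y → H x y) {u v : V}
    (h : Relation.TransGen (TwoLayer π a b H P) u v) :
    (a (π u) = u ∧ a (π v) = v ∧ Relation.TransGen H (π u) (π v)) ∨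
      (b (π u) = u ∧ b (π v) = v ∧ Relation.TransGen H (π v) (π u)) := by
  induction h with
  | single h =>
    rcases h with ⟨h₁, h₂, h₃⟩ | ⟨h₁, h₂, h₃⟩
    · exact Or.inl ⟨h₁, h₂, .single h₃⟩
    · exact Or.inr ⟨h₁, h₂, .single (hPH _ _ h₃)⟩
  | tail _ h ih =>
    rcases ih with ⟨i₁, i₂, i₃⟩ | ⟨i₁, i₂, i₃⟩ <;> rcases h with ⟨h₁, h₂, h₃⟩ | ⟨h₁, h₂, h₃⟩
    · exact Or.inl ⟨i₁, h₂, i₃.tail h₃⟩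
    · exact absurd (i₂.trans h₁.symm) (hab _ _)
    · exact absurd (h₁.trans i₂.symm) (hab _ _)
    · exact Or.inr ⟨i₁, h₂, i₃.head (hPH _ _ h₃)⟩

theorem isDAG_twoLayer (hab : ∀ i i', a i ≠ b i') (hPH : ∀ x y, P x y → H x y)
    (hH : IsDAG H) : IsDAG (TwoLayer π a b H P) := by
  intro v hv
  rcases transGen_twoLayer hab hPH hv with h | h <;> exact hH _ h.2.2

theorem twoLayer_fst_iff (hab : ∀ i i', a i ≠ b i') (ha : ∀ i, π (a i) = i) (x y : I) :
    TwoLayer π a b H P (a x) (a y) ↔ H x y := by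
  simp [TwoLayer, ha, (hab _ _).symm]

theorem twoLayer_snd_iff (hab : ∀ i i', a i ≠ b i') (hb : ∀ i, π (b i) = i) (x y : I) :
    TwoLayer π a b H P (b x) (b y) ↔ P y x := by
  simp [TwoLayer, hb, hab]

theorem dConn_twoLayer_of_dConn (hab : ∀ i i', a i ≠ b i') (ha : ∀ i, π (a i) = i)
    {T : Set I} {i j : I} (h : DConn H T i j) :
    DConn (TwoLayer π a b H P) (π ⁻¹' T) (a i) (a j) := by
  obtain ⟨n, p, hinj, rfl, rfl, hadj, hint⟩ := h
  have ha' : Function.Injective a := Function.LeftInverse.injective ha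
  refine ⟨n, a ∘ p, ha'.comp hinj, rfl, rfl, fun k h => ?_, fun k h => ?_⟩
  · simpa only [Adj, Function.comp, twoLayer_fst_iff hab ha] using hadj k h
  · simp only [Function.comp, twoLayer_fst_iff hab ha, Set.mem_preimage, ha]
    refine ⟨fun hc => ((hint k h).1 hc).imp_right ?_, (hint k h).2⟩
    rintro ⟨d, hd, hanc⟩
    refine ⟨a d, (ha d).symm ▸ hd, ?_⟩
    exact Relation.TransGen.lift a (fun x y => (twoLayer_fst_iff hab ha x y).2) _ _ hanc

theorem forall_of_adj {A : V → V → Prop} {Q : V → Prop} (hQ : ∀ u v, Adj A u v → Q u → Q v)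
    {n : ℕ} {p : Fin (n + 2) → V}
    (hadj : ∀ (k : ℕ) (h : k + 1 < n + 2), Adj A (p ⟨k, Nat.lt_of_succ_lt h⟩) (p ⟨k + 1, h⟩))
    (h0 : Q (p 0)) (t : Fin (n + 2)) : Q (p t) := by
  obtain ⟨k, hk⟩ := t
  induction k with
  | zero => exact h0
  | succ k ih => exact hQ _ _ (hadj k hk) (ih _)

theorem dConn_of_dConn_twoLayer (hab : ∀ i i', a i ≠ b i') (ha : ∀ i, π (a i) = i)
    (hb : ∀ i, π (b i) = i) (hH : IsDAG H) (hPH : ∀ x y, P x y → H x y)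
    (hP : Relator.BiUnique P) {T : Set I} {x y : V}
    (h : DConn (TwoLayer π a b H P) (π ⁻¹' T) x y) : DConn H T (π x) (π y) := by
  obtain ⟨n, p, hinj, rfl, rfl, hadj, hint⟩ := h
  have hlayer : (∀ t, a (π (p t)) = p t) ∨ ∀ t, b (π (p t)) = p t := by
    have hfst : a (π (p 0)) = p 0 ∨ b (π (p 0)) = p 0 := by
      rcases hadj 0 (by omega) with (h | h) | (h | h)
      · exact Or.inl h.1
      · exact Or.inr h.1
      · exact Or.inl h.2.1
      · exact Or.inr h.2.1
    refine hfst.imp (forall_of_adj (Q := fun u => a (π u) = u) ?_ hadj)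
      (forall_of_adj (Q := fun u => b (π u) = u) ?_ hadj)
    · rintro u v ((h | h) | (h | h)) hu
      · exact h.2.1
      · exact absurd (hu.trans h.1.symm) (hab _ _)
      · exact h.1
      · exact absurd (hu.trans h.2.1.symm) (hab _ _)
    · rintro u v ((h | h) | (h | h)) hu
      · exact absurd (h.1.trans hu.symm) (hab _ _)
      · exact h.2.1
      · exact absurd (h.2.1.trans hu.symm) (hab _ _)
      · exact h.1
  rcases hlayer with hl | hl
  · obtain ⟨q, rfl⟩ : ∃ q : Fin (n + 2) → I, p = a ∘ q := ⟨π ∘ p, funext fun t => (hl t).symm⟩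
    simp only [Adj, Function.comp, twoLayer_fst_iff hab ha, Set.mem_preimage, ha] at hadj hint ⊢
    refine ⟨n, q, hinj.of_comp (f := a), rfl, rfl, hadj, fun k h =>
      ⟨fun hc => ((hint k h).1 hc).imp_right ?_, (hint k h).2⟩⟩
    rintro ⟨d, hd, hanc⟩
    rcases transGen_twoLayer hab hPH hanc with h' | h'
    · exact ⟨π d, hd, by simpa only [Ancestor, ha] using h'.2.2⟩
    · exact absurd h'.1.symm (hab _ _)
  · obtain ⟨q, rfl⟩ : ∃ q : Fin (n + 2) → I, p = b ∘ q := ⟨π ∘ p, funext fun t => (hl t).symm⟩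
    simp only [Adj, Function.comp, twoLayer_snd_iff hab hb, Set.mem_preimage, hb] at hadj hint ⊢
    have hq : Function.Injective q := hinj.of_comp (f := b)
    refine ⟨n, q, hq, rfl, rfl, fun k h => (hadj k h).symm.imp (hPH _ _) (hPH _ _), fun k h => ?_⟩
    have hne : q ⟨k, by omega⟩ ≠ q ⟨k + 2, h⟩ := fun e => by
      have := congrArg Fin.val (hq e)
      simp at this
    have asymm : ∀ {u v}, H u v → ¬ P v u := fun huv hvu =>
      hH _ ((Relation.TransGen.single huv).tail (hPH _ _ hvu))
    refine ⟨fun ⟨h₁, h₂⟩ => ?_, fun _ => (hint k h).2 fun ⟨h₁, h₂⟩ => hne (hP.2 h₁ h₂)⟩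
    have e₁ := (hadj k (by omega)).resolve_left (asymm h₁)
    have e₂ := (hadj (k + 1) h).resolve_right (asymm h₂)
    exact absurd (hP.1 e₁ e₂) hne

end TwoLayer

/-- Theorem 4 of the paper. If every group has size at least 2
and `W_j` is an ancestor of `W_k` in the group DAG `H`, then there is a variable
DAG `G` that is groupwise Markov equivalent to `H` given the grouping and in which
some node of `W_k` is an ancestor of some node of `W_j`; hence ancestry in the
group DAG does not imply strong group causality. -/
theorem ancestry_not_strong_group_cause
    {V I : Type*} [Fintype V] [Fintype I]
    (π : V → I) (hπ : Function.Surjective π)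
    (H : I → I → Prop) (hH : IsDAG H)
    (hsize : ∀ i : I, 2 ≤ (π ⁻¹' {i}).ncard)
    (j k : I) (hjk : Ancestor H j k) :
    ∃ G : V → V → Prop, IsDAG G ∧ GroupwiseMarkovEquiv G π H ∧
      ∃ wk wj : V, π wk = k ∧ π wj = j ∧ Ancestor G wk wj := by
  have hpair : ∀ i, ∃ u v, π u = i ∧ π v = i ∧ u ≠ v := by
    intro i
    obtain ⟨u, hu, v, hv, huv⟩ := (Set.one_lt_ncard).1 (hsize i)
    exact ⟨u, v, hu, hv, huv⟩
  choose a b ha hb hne using hpair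
  have hab : ∀ i i', a i ≠ b i' := fun i i' e => by
    obtain rfl : i = i' := by rw [← ha i, e, hb]
    exact hne i e
  obtain ⟨P, hPH, hP, hPjk⟩ := exists_biunique_subrelation hH hjk
  refine ⟨TwoLayer π a b H P, isDAG_twoLayer hab hPH hH, fun i i' _ T _ _ => ⟨?_, ?_⟩,
    b k, b j, hb k, hb j, ?_⟩
  · exact fun h hc => h _ (ha i) _ (ha i') (dConn_twoLayer_of_dConn hab ha hc)
  · rintro h x rfl y rfl hc
    exact h (dConn_of_dConn_twoLayer hab ha hb hH hPH hP hc)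
  · exact Relation.TransGen.lift b (fun x y => (twoLayer_snd_iff hab hb x y).2) _ _ (Relation.TransGen.swap _ _ hPjk)

end GroupBN
end

section
/- Let H be a group DAG on a grouping W of a finite node set N = ∪W, and choose one designated node w_i ∈ W_i for each group W_i ∈ W. Let G be the variable DAG on N whose arcs are exactly the arcs w_i → w_l for each arc W_i → W_l of H (all other nodes of N are isolated in G). Then G is groupwise Markov equivalent to H given W. -/
open scoped Classical

namespace GroupBN

variable {V : Type*} {I : Type*}

variable {S : V → Type*}

/-- The image of the digraph `H` under a map of nodes `w`: its arcs are exactly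
`w i → w l` for the arcs `i → l` of `H`. -/
def imageArcs (H : I → I → Prop) (w : I → V) (u v : V) : Prop :=
  ∃ i l : I, H i l ∧ u = w i ∧ v = w l

theorem imageArcs_apply_iff {H : I → I → Prop} {w : I → V} (hw : Function.Injective w)
    {i l : I} : imageArcs H w (w i) (w l) ↔ H i l := by
  constructor
  · rintro ⟨a, b, hab, ha, hb⟩
    rwa [hw ha, hw hb]
  · exact fun h => ⟨i, l, h, rfl, rfl⟩

theorem adj_imageArcs_apply_iff {H : I → I → Prop} {w : I → V} (hw : Function.Injective w)
    {i l : I} : Adj (imageArcs H w) (w i) (w l) ↔ Adj H i l := by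
  simp only [Adj, imageArcs_apply_iff hw]

theorem Adj.mem_range_of_imageArcs {H : I → I → Prop} {w : I → V} {u v : V}
    (h : Adj (imageArcs H w) u v) : u ∈ Set.range w ∧ v ∈ Set.range w := by
  rcases h with ⟨i, l, -, rfl, rfl⟩ | ⟨i, l, -, rfl, rfl⟩ <;> simp

theorem ancestor_imageArcs_apply_iff {H : I → I → Prop} {w : I → V}
    (hw : Function.Injective w) {i : I} {v : V} :
    Ancestor (imageArcs H w) (w i) v ↔ ∃ l, Ancestor H i l ∧ w l = v := by
  constructor
  · intro h
    induction h with
    | single h =>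
      obtain ⟨a, b, hab, ha, rfl⟩ := h
      exact ⟨b, .single (hw ha ▸ hab), rfl⟩
    | tail _ h ih =>
      obtain ⟨l, hl, rfl⟩ := ih
      obtain ⟨a, b, hab, ha, rfl⟩ := h
      exact ⟨b, hl.tail (hw ha ▸ hab), rfl⟩
  · rintro ⟨l, hl, rfl⟩
    exact Relation.TransGen.lift w (fun _ _ => (imageArcs_apply_iff hw).2) _ _ hl

theorem exists_mem_ancestor_imageArcs_iff {H : I → I → Prop} {w : I → V}
    (hw : Function.Injective w) {Z : Set V} {i : I} :
    (∃ d ∈ Z, Ancestor (imageArcs H w) (w i) d) ↔ ∃ l ∈ w ⁻¹' Z, Ancestor H i l := by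
  simp only [ancestor_imageArcs_apply_iff hw, Set.mem_preimage]
  constructor
  · rintro ⟨_, hd, l, hl, rfl⟩
    exact ⟨l, hd, hl⟩
  · rintro ⟨l, hd, hl⟩
    exact ⟨w l, hd, l, hl, rfl⟩

/-- The d-connections of the image of `H` under an injective map are exactly the images of
the d-connections of `H`. -/
theorem dConn_imageArcs_iff {H : I → I → Prop} {w : I → V} (hw : Function.Injective w)
    {Z : Set V} {u v : V} :
    DConn (imageArcs H w) Z u v ↔ ∃ i j, w i = u ∧ w j = v ∧ DConn H (w ⁻¹' Z) i j := by
  constructor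
  · rintro ⟨n, pth, hinj, rfl, rfl, hadj, hint⟩
    have hrange : ∀ k, ∃ i, w i = pth k := by
      rintro ⟨_ | k, hk⟩
      · exact (hadj 0 (by omega)).mem_range_of_imageArcs.1
      · exact (hadj k hk).mem_range_of_imageArcs.2
    choose q hq using hrange
    obtain rfl : w ∘ q = pth := funext hq
    simp only [Function.comp_apply, adj_imageArcs_apply_iff hw, imageArcs_apply_iff hw,
      exists_mem_ancestor_imageArcs_iff hw] at hadj hint
    exact ⟨_, _, rfl, rfl, n, q, hinj.of_comp, rfl, rfl, hadj, hint⟩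
  · rintro ⟨_, _, rfl, rfl, n, q, hinj, rfl, rfl, hadj, hint⟩
    refine ⟨n, w ∘ q, hw.comp hinj, rfl, rfl, ?_⟩
    simp only [Function.comp_apply, adj_imageArcs_apply_iff hw, imageArcs_apply_iff hw,
      exists_mem_ancestor_imageArcs_iff hw]
    exact ⟨hadj, hint⟩

/-- construction in the proof of Theorem 4 of the paper. Choosing
one designated node `w i` in each group `W_i`, the variable DAG whose arcs are
exactly `w i → w l` for each arc `i → l` of the group DAG `H` is groupwise Markov
equivalent to `H` given the grouping. -/
theorem designated_node_dag_groupwise_equiv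
    {V I : Type*} [Fintype V] [Fintype I]
    (π : V → I) (hπ : Function.Surjective π)
    (H : I → I → Prop) (hH : IsDAG H)
    (w : I → V) (hw : ∀ i : I, π (w i) = i) :
    GroupwiseMarkovEquiv
      (fun u v : V => ∃ i l : I, H i l ∧ u = w i ∧ v = w l) π H := by
  have hinj : Function.Injective w := Function.LeftInverse.injective hw
  intro i j _ T _ _
  change DSepSet (imageArcs H w) _ _ _ ↔ _
  have hT : w ⁻¹' (π ⁻¹' T) = T := by
    ext i
    simp [hw]
  simp only [DSepSet, DSep, dConn_imageArcs_iff hinj, hT, Set.mem_preimage,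
    Set.mem_singleton_iff]
  constructor
  · exact fun h hc => h (w i) (hw i) (w j) (hw j) ⟨i, j, rfl, rfl, hc⟩
  · rintro h _ hx _ hy ⟨a, b, rfl, rfl, hc⟩
    rw [hw] at hx hy
    exact h (hx ▸ hy ▸ hc)

end GroupBN
end
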